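/- arXiv:2208.12879 — 4 statements merged into one kernel-verified Lean document; each statement's English description precedes it below -/
import Mathlib

section
/- Let n ∈ ℕ, t₀ ∈ ℝ, τ > 0, and set t_k := t₀ + k·τ for k ∈ ℕ. Let f : ℝ × ℝ^n × ℝ^n → ℝ^n, let x₀ : ℝ → ℝ^n be a history function, and suppose that for every k ≥ 1 there is a function x_k : ℝ → ℝ^n such that x_k(t_{k-1}) = x_{k-1}(t_{k-1}) (with x₀ the history function for k = 1) and for every t ∈ [t_{k-1}, t_k], x_k has derivative f(t, x_k(t), x_{k-1}(t − τ)) at t within [t_{k-1}, t_k]. Define x : ℝ → ℝ^n by x(t) = x₀(t) for t < t₀ and x(t) = x_k(t) for t ∈ [t_{k-1}, t_k) with k ≥ 1. Then x(t) = x₀(t) for all t ≤ t₀, and for every k ≥ 1 and every t ∈ [t_{k-1}, t_k], x has derivative f(t, x(t), x(t − τ)) at t within [t_{k-1}, t_k]; that is, x solves the delay differential equation initial value problem x′(t) = f(t, x(t), x(t − τ)) for t ≥ t₀ with x(t) = x₀(t) for t ≤ t₀. -/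
open Set

/-- Method of steps: if for every `k ≥ 1` (written `k + 1` with `k : ℕ`) the function
`X (k+1)` solves the ODE `x' t = f t (x t) (X k (t - τ))` on `[t₀ + kτ, t₀ + (k+1)τ]`
with initial value matching `X k` at `t₀ + kτ` (where `X 0 = x₀` is the history function),
then the piecewise-defined function `x` (equal to `x₀` for `t < t₀` and to `X (k+1)` on
`[t₀ + kτ, t₀ + (k+1)τ)`) agrees with `x₀` for all `t ≤ t₀` and solves the delay
differential equation `x' t = f t (x t) (x (t - τ))` on each interval, i.e. for `t ≥ t₀`. -/
theorem method_of_steps_solves_dde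
    (n : ℕ) (t₀ τ : ℝ) (hτ : 0 < τ)
    (f : ℝ → EuclideanSpace ℝ (Fin n) → EuclideanSpace ℝ (Fin n) → EuclideanSpace ℝ (Fin n))
    (x₀ : ℝ → EuclideanSpace ℝ (Fin n))
    (X : ℕ → ℝ → EuclideanSpace ℝ (Fin n))
    (hX0 : X 0 = x₀)
    (hinit : ∀ k : ℕ, X (k + 1) (t₀ + k * τ) = X k (t₀ + k * τ))
    (hode : ∀ k : ℕ, ∀ t ∈ Icc (t₀ + k * τ) (t₀ + (k + 1) * τ),
      HasDerivWithinAt (X (k + 1)) (f t (X (k + 1) t) (X k (t - τ)))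
        (Icc (t₀ + k * τ) (t₀ + (k + 1) * τ)) t)
    (x : ℝ → EuclideanSpace ℝ (Fin n))
    (hxhist : ∀ t < t₀, x t = x₀ t)
    (hxpiece : ∀ k : ℕ, ∀ t ∈ Ico (t₀ + k * τ) (t₀ + (k + 1) * τ), x t = X (k + 1) t) :
    (∀ t ≤ t₀, x t = x₀ t) ∧
    ∀ k : ℕ, ∀ t ∈ Icc (t₀ + k * τ) (t₀ + (k + 1) * τ),
      HasDerivWithinAt x (f t (x t) (x (t - τ)))
        (Icc (t₀ + k * τ) (t₀ + (k + 1) * τ)) t := by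
  have eq_piece : ∀ k : ℕ, ∀ t ∈ Icc (t₀ + k * τ) (t₀ + (k + 1) * τ), x t = X (k + 1) t := by
    intro k t ht
    rcases ht.2.lt_or_eq with hlt | rfl
    · exact hxpiece k t ⟨ht.1, hlt⟩
    · have hnext := hxpiece (k + 1) (t₀ + (k + 1) * τ) (by
        constructor <;> push_cast <;> linarith)
      have hmatch := hinit (k + 1)
      push_cast at hmatch
      exact hnext.trans hmatch
  have eq_hist : ∀ t ≤ t₀, x t = x₀ t := by
    intro t ht
    rcases ht.lt_or_eq with hlt | rfl
    · exact hxhist t hlt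
    · have hstart := eq_piece 0 t (by constructor <;> push_cast <;> linarith)
      have hmatch := hinit 0
      simp only [Nat.cast_zero, zero_mul, add_zero, hX0] at hmatch
      exact hstart.trans hmatch
  refine ⟨eq_hist, fun k t ht => ?_⟩
  have eq_delay : x (t - τ) = X k (t - τ) := by
    cases k with
    | zero =>
      rw [hX0]
      have := ht.2
      push_cast at this
      exact eq_hist _ (by linarith)
    | succ j =>
      obtain ⟨hl, hr⟩ := ht
      push_cast at hl hr
      exact eq_piece j _ ⟨by linarith, by linarith⟩
  rw [eq_piece k t ht, eq_delay]
  exact (hode k t ht).congr (eq_piece k) (eq_piece k t ht)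
end

section
/- Let n ∈ ℕ, t₀ ∈ ℝ, T > t₀, and τ > 0. Let f : ℝ × ℝ^n × ℝ^n → ℝ^n be continuous and suppose there is L ≥ 0 such that ‖f(t, x, y) − f(t, x̄, ȳ)‖ ≤ L(‖x − x̄‖ + ‖y − ȳ‖) for all t ∈ [t₀, T] and x, x̄, y, ȳ ∈ ℝ^n. Let x₀ : ℝ → ℝ^n be continuous. Then there exists a continuous function x : ℝ → ℝ^n with x(t) = x₀(t) for all t ≤ t₀ such that for every t ∈ [t₀, T], x has derivative f(t, x(t), x(t − τ)) at t within [t₀, T]. -/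
open Set

/-- The curve that follows `x₀` up to time `a` and has velocity `u` afterwards. -/
noncomputable def curveOfVelocity {E : Type*} [NormedAddCommGroup E] [NormedSpace ℝ E]
    (x₀ : ℝ → E) (a : ℝ) (u : ℝ → E) (t : ℝ) : E :=
  x₀ (min t a) + ∫ s in a..max t a, u s

section curveOfVelocity

variable {E : Type*} [NormedAddCommGroup E] [NormedSpace ℝ E] {x₀ u v : ℝ → E} {a t : ℝ}

theorem curveOfVelocity_of_le (h : t ≤ a) : curveOfVelocity x₀ a u t = x₀ t := by
  simp [curveOfVelocity, h]

theorem curveOfVelocity_of_ge (h : a ≤ t) :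
    curveOfVelocity x₀ a u t = x₀ a + ∫ s in a..t, u s := by
  simp [curveOfVelocity, h]

theorem continuous_curveOfVelocity (hx₀ : Continuous x₀) (hu : Continuous u) :
    Continuous (curveOfVelocity x₀ a u) :=
  (hx₀.comp (by fun_prop)).add <|
    (intervalIntegral.continuous_primitive (fun b c => hu.intervalIntegrable b c) a).comp
      (by fun_prop : Continuous fun t : ℝ => max t a)

theorem hasDerivWithinAt_curveOfVelocity [CompleteSpace E] {b : ℝ} (hu : Continuous u)
    (ht : t ∈ Icc a b) :
    HasDerivWithinAt (curveOfVelocity x₀ a u) (u t) (Icc a b) t :=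
  ((hu.integral_hasStrictDerivAt a t).hasDerivAt.const_add (x₀ a)).hasDerivWithinAt.congr
    (fun _ hs => curveOfVelocity_of_ge hs.1) (curveOfVelocity_of_ge ht.1)

theorem norm_curveOfVelocity_sub_le (hu : Continuous u) (hv : Continuous v) {C k : ℝ}
    (hC : 0 ≤ C) (hk : 0 < k) (h : ∀ s, ‖u s - v s‖ ≤ C * Real.exp (k * s)) (t : ℝ) :
    ‖curveOfVelocity x₀ a u t - curveOfVelocity x₀ a v t‖ ≤ C / k * Real.exp (k * t) := by
  rcases le_total t a with hta | hat
  · rw [curveOfVelocity_of_le hta, curveOfVelocity_of_le hta, sub_self, norm_zero]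
    positivity
  rw [curveOfVelocity_of_ge hat, curveOfVelocity_of_ge hat, add_sub_add_left_eq_sub,
    ← intervalIntegral.integral_sub (hu.intervalIntegrable _ _) (hv.intervalIntegrable _ _)]
  have hcont : Continuous fun s : ℝ => C * Real.exp (k * s) := by fun_prop
  have hderiv (s : ℝ) :
      HasDerivAt (fun s => C / k * Real.exp (k * s)) (C * Real.exp (k * s)) s := by
    refine (((hasDerivAt_id' s).const_mul k).exp.const_mul (C / k)).congr_deriv ?_
    field_simp
  calc ‖∫ s in a..t, (u s - v s)‖ ≤ ∫ s in a..t, C * Real.exp (k * s) :=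
        intervalIntegral.norm_integral_le_of_norm_le hat (.of_forall fun s _ => h s)
          (hcont.intervalIntegrable _ _)
    _ = C / k * Real.exp (k * t) - C / k * Real.exp (k * a) :=
        intervalIntegral.integral_eq_sub_of_hasDerivAt (fun s _ => hderiv s)
          (hcont.intervalIntegrable _ _)
    _ ≤ C / k * Real.exp (k * t) := sub_le_self _ (by positivity)

end curveOfVelocity

/-- The velocity of a solution of the delay equation, rescaled by an exponential weight, is the
fixed point of a contraction. -/
theorem exists_velocity_eq {E : Type*} [NormedAddCommGroup E] [NormedSpace ℝ E] [CompleteSpace E]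
    {a b τ L : ℝ} (hab : a ≤ b) (hτ : 0 ≤ τ) {f : ℝ → E → E → E}
    (hf : Continuous fun p : ℝ × E × E => f p.1 p.2.1 p.2.2) (hL : 0 ≤ L)
    (hlip : ∀ t ∈ Icc a b, ∀ x x' y y' : E,
      ‖f t x y - f t x' y'‖ ≤ L * (‖x - x'‖ + ‖y - y'‖))
    {x₀ : ℝ → E} (hx₀ : Continuous x₀) :
    ∃ u : ℝ → E, Continuous u ∧ ∀ t ∈ Icc a b,
      u t = f t (curveOfVelocity x₀ a u t) (curveOfVelocity x₀ a u (t - τ)) := by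
  set k : ℝ := 4 * L + 1
  have hk : 0 < k := by positivity
  let vel (w : C(Icc a b, E)) (t : ℝ) : E := Real.exp (k * t) • IccExtend hab w t
  have hvel (w : C(Icc a b, E)) : Continuous (vel w) :=
    (by fun_prop : Continuous fun t : ℝ => Real.exp (k * t)).smul w.continuous.Icc_extend'
  let X (w : C(Icc a b, E)) : ℝ → E := curveOfVelocity x₀ a (vel w)
  have hX (w : C(Icc a b, E)) : Continuous (X w) := continuous_curveOfVelocity hx₀ (hvel w)
  have hXdist (w w' : C(Icc a b, E)) (t : ℝ) :
      ‖X w t - X w' t‖ ≤ dist w w' / k * Real.exp (k * t) := by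
    refine norm_curveOfVelocity_sub_le (hvel w) (hvel w') dist_nonneg hk (fun s => ?_) t
    rw [← smul_sub, norm_smul, Real.norm_of_nonneg (Real.exp_nonneg _), mul_comm, ← dist_eq_norm]
    gcongr
    exact ContinuousMap.dist_apply_le_dist _
  let Φ (w : C(Icc a b, E)) : C(Icc a b, E) :=
    { toFun := fun t => Real.exp (-(k * t)) • f t (X w t) (X w (t - τ))
      continuous_toFun := by
        have := hX w
        exact (by fun_prop : Continuous fun t : Icc a b => Real.exp (-(k * (t : ℝ)))).smul
          (hf.comp (by fun_prop :
            Continuous fun t : Icc a b => ((t : ℝ), X w t, X w (t - τ)))) }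
  have hΦ : ContractingWith (1 / 2) Φ := by
    refine ⟨by norm_num, LipschitzWith.of_dist_le_mul fun w w' => ?_⟩
    refine (ContinuousMap.dist_le (by positivity)).2 fun t => ?_
    have hdelay : ‖X w (t - τ) - X w' (t - τ)‖ ≤ dist w w' / k * Real.exp (k * t) := by
      refine (hXdist w w' _).trans ?_
      gcongr
      linarith
    have hratio : 2 * L / k ≤ 1 / 2 := by
      rw [div_le_iff₀ hk]
      simp only [k]
      linarith
    change dist (Real.exp (-(k * t)) • f t (X w t) (X w (t - τ)))
      (Real.exp (-(k * t)) • f t (X w' t) (X w' (t - τ))) ≤ _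
    rw [dist_eq_norm, ← smul_sub, norm_smul, Real.norm_of_nonneg (Real.exp_nonneg _)]
    calc Real.exp (-(k * t)) * ‖f t (X w t) (X w (t - τ)) - f t (X w' t) (X w' (t - τ))‖
        ≤ Real.exp (-(k * t)) * (L * (dist w w' / k * Real.exp (k * t) +
            dist w w' / k * Real.exp (k * t))) := by
          gcongr
          refine (hlip t t.2 _ _ _ _).trans ?_
          gcongr
          exact hXdist w w' t
      _ = 2 * L / k * dist w w' := by
          rw [Real.exp_neg]
          field_simp
          ring
      _ ≤ ((1 / 2 : NNReal) : ℝ) * dist w w' := by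
          push_cast
          gcongr
  have : Nonempty C(Icc a b, E) := ⟨0⟩
  set w := ContractingWith.fixedPoint Φ hΦ
  refine ⟨vel w, hvel w, fun t ht => ?_⟩
  have hfix : Φ w ⟨t, ht⟩ = w ⟨t, ht⟩ := congrArg (· ⟨t, ht⟩) hΦ.fixedPoint_isFixedPt
  change Real.exp (k * t) • IccExtend hab w t = _
  rw [IccExtend_of_mem _ _ ht, ← hfix]
  change Real.exp (k * t) • Real.exp (-(k * t)) • f t (X w t) (X w (t - τ)) = _
  rw [smul_smul, ← Real.exp_add, add_neg_cancel, Real.exp_zero, one_smul]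

/-- Existence of solutions for a constant-delay DDE initial value problem on `[t₀, T]`:
if `f` is continuous and Lipschitz in its last two arguments (uniformly for `t ∈ [t₀, T]`)
and the history function `x₀` is continuous, then there is a continuous function `x`
agreeing with `x₀` for `t ≤ t₀` that satisfies
`x' t = f t (x t) (x (t - τ))` for all `t ∈ [t₀, T]` (derivative within `[t₀, T]`). -/
theorem dde_existence
    (n : ℕ) (t₀ T τ : ℝ) (hT : t₀ < T) (hτ : 0 < τ)
    (f : ℝ → EuclideanSpace ℝ (Fin n) → EuclideanSpace ℝ (Fin n) → EuclideanSpace ℝ (Fin n))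
    (hf : Continuous fun p : ℝ × EuclideanSpace ℝ (Fin n) × EuclideanSpace ℝ (Fin n) =>
      f p.1 p.2.1 p.2.2)
    (L : ℝ) (hL : 0 ≤ L)
    (hlip : ∀ t ∈ Icc t₀ T, ∀ x x' y y' : EuclideanSpace ℝ (Fin n),
      ‖f t x y - f t x' y'‖ ≤ L * (‖x - x'‖ + ‖y - y'‖))
    (x₀ : ℝ → EuclideanSpace ℝ (Fin n)) (hx₀ : Continuous x₀) :
    ∃ x : ℝ → EuclideanSpace ℝ (Fin n), Continuous x ∧ (∀ t ≤ t₀, x t = x₀ t) ∧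
      ∀ t ∈ Icc t₀ T, HasDerivWithinAt x (f t (x t) (x (t - τ))) (Icc t₀ T) t := by
  obtain ⟨u, hu, hu_eq⟩ := exists_velocity_eq hT.le hτ.le hf hL hlip hx₀
  refine ⟨curveOfVelocity x₀ t₀ u, continuous_curveOfVelocity hx₀ hu,
    fun t ht => curveOfVelocity_of_le ht, fun t ht => ?_⟩
  rw [← hu_eq t ht]
  exact hasDerivWithinAt_curveOfVelocity hu ht
end

section
/- Let n ∈ ℕ, t₀ ∈ ℝ, T > t₀, and τ > 0. Let f : ℝ × ℝ^n × ℝ^n → ℝ^n and suppose there is L ≥ 0 such that ‖f(t, x, y) − f(t, x̄, ȳ)‖ ≤ L(‖x − x̄‖ + ‖y − ȳ‖) for all t ∈ [t₀, T] and x, x̄, y, ȳ ∈ ℝ^n. Let x₀ : ℝ → ℝ^n, and let x, y : ℝ → ℝ^n be continuous functions such that x(t) = x₀(t) = y(t) for all t ≤ t₀ and, for every t ∈ [t₀, T], both x and y have derivative f(t, x(t), x(t − τ)) and f(t, y(t), y(t − τ)) respectively at t within [t₀, T]. Then x(t) = y(t) for all t ∈ [t₀, T]. -/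
open Set

/-- Uniqueness of solutions for a constant-delay DDE initial value problem on `[t₀, T]`:
if `f` is Lipschitz in its last two arguments (uniformly for `t ∈ [t₀, T]`), then any two
continuous solutions `x` and `y` agreeing with the history function `x₀` for `t ≤ t₀` and
satisfying the DDE `x' t = f t (x t) (x (t - τ))` on `[t₀, T]` (derivatives within
`[t₀, T]`) coincide on `[t₀, T]`. -/
theorem dde_uniqueness
    (n : ℕ) (t₀ T τ : ℝ) (hT : t₀ < T) (hτ : 0 < τ)
    (f : ℝ → EuclideanSpace ℝ (Fin n) → EuclideanSpace ℝ (Fin n) → EuclideanSpace ℝ (Fin n))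
    (L : ℝ) (hL : 0 ≤ L)
    (hlip : ∀ t ∈ Icc t₀ T, ∀ x x' y y' : EuclideanSpace ℝ (Fin n),
      ‖f t x y - f t x' y'‖ ≤ L * (‖x - x'‖ + ‖y - y'‖))
    (x₀ x y : ℝ → EuclideanSpace ℝ (Fin n))
    (hx : Continuous x) (hy : Continuous y)
    (hxhist : ∀ t ≤ t₀, x t = x₀ t) (hyhist : ∀ t ≤ t₀, y t = x₀ t)
    (hxdde : ∀ t ∈ Icc t₀ T, HasDerivWithinAt x (f t (x t) (x (t - τ))) (Icc t₀ T) t)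
    (hydde : ∀ t ∈ Icc t₀ T, HasDerivWithinAt y (f t (y t) (y (t - τ))) (Icc t₀ T) t) :
    ∀ t ∈ Icc t₀ T, x t = y t := by
  have steps : ∀ k : ℕ, ∀ t ≤ T, t ≤ t₀ + k * τ → x t = y t := by
    intro k
    induction k with
    | zero =>
      intro t _ ht
      have ht' : t ≤ t₀ := by simpa using ht
      rw [hxhist t ht', hyhist t ht']
    | succ k ih =>
      intro b hbT hb
      rcases le_or_gt b t₀ with hb₀ | hb₀
      · rw [hxhist b hb₀, hyhist b hb₀]
      have hmem : ∀ s ∈ Ico t₀ b, s ∈ Icc t₀ T := fun s hs => ⟨hs.1, hs.2.le.trans hbT⟩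
      have hnhds : ∀ s ∈ Ico t₀ b, Icc t₀ T ∈ nhdsWithin s (Ici s) := fun s hs =>
        Filter.mem_of_superset (Icc_mem_nhdsGE (hs.2.trans_le hbT)) (Icc_subset_Icc_left hs.1)
      refine ODE_solution_unique_of_mem_Icc_right (v := fun s u => f s u (x (s - τ)))
        (s := fun _ => univ) (K := NNReal.mk L hL) ?_ hx.continuousOn ?_ (fun _ _ => mem_univ _)
        hy.continuousOn ?_ (fun _ _ => mem_univ _) ?_ (right_mem_Icc.2 hb₀.le)
      · intro s hs
        refine (LipschitzWith.of_dist_le_mul fun u w => ?_).lipschitzOnWith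
        rw [dist_eq_norm, dist_eq_norm, NNReal.coe_mk]
        simpa using hlip s (hmem s hs) u w (x (s - τ)) (x (s - τ))
      · exact fun s hs => (hxdde s (hmem s hs)).mono_of_mem_nhdsWithin (hnhds s hs)
      · intro s hs
        have hdelay : x (s - τ) = y (s - τ) := by
          push_cast at hb
          exact ih _ (by linarith [hs.2]) (by linarith [hs.2])
        simp only [hdelay]
        exact (hydde s (hmem s hs)).mono_of_mem_nhdsWithin (hnhds s hs)
      · rw [hxhist t₀ le_rfl, hyhist t₀ le_rfl]
  intro t ht
  obtain ⟨k, hk⟩ := exists_nat_ge ((t - t₀) / τ)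
  rw [div_le_iff₀ hτ] at hk
  exact steps k t ht.2 (by linarith)
end

section
/- Let n ∈ ℕ, t₀ ∈ ℝ, τ > 0, and k ∈ ℕ. Let f : ℝ × ℝ^n × ℝ^n → ℝ^n be of class C^k, let x₀ : ℝ → ℝ^n be continuous, and let x : ℝ → ℝ^n be a continuous function with x(t) = x₀(t) for all t ≤ t₀ such that x is differentiable at every t > t₀ with x′(t) = f(t, x(t), x(t − τ)). Then for every integer j with 1 ≤ j ≤ k + 1, the function x is of class C^j on the open interval (t₀ + (j − 1)τ, ∞). In other words, the derivative jump discontinuity at the initial time t₀ propagates only as discontinuities of successively higher-order derivatives at the time points t₀ + mτ: crossing each subsequent multiple of the delay gains one additional order of smoothness, up to the smoothness of f. -/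
open Set

/-- One smoothing step: if a solution is `C^m` on `(a - τ, ∞)` with `t₀ ≤ a`, then it is
`C^(m+1)` on `(a, ∞)`. -/
theorem contDiffOn_succ_of_hasDerivAt_delay {E : Type*} [NormedAddCommGroup E]
    [NormedSpace ℝ E] {t₀ τ a : ℝ} (hτ : 0 ≤ τ) (ha : t₀ ≤ a) {m : ℕ} {f : ℝ → E → E → E}
    (hf : ContDiff ℝ m fun p : ℝ × E × E => f p.1 p.2.1 p.2.2) {x : ℝ → E}
    (hxdde : ∀ t > t₀, HasDerivAt x (f t (x t) (x (t - τ))) t)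
    (hx : ContDiffOn ℝ m x (Ioi (a - τ))) :
    ContDiffOn ℝ (m + 1) x (Ioi a) := by
  have hderiv : ∀ t ∈ Ioi a, HasDerivAt x (f t (x t) (x (t - τ))) t :=
    fun t ht => hxdde t (ha.trans_lt ht)
  rw [contDiffOn_succ_iff_deriv_of_isOpen isOpen_Ioi]
  refine ⟨fun t ht => (hderiv t ht).differentiableAt.differentiableWithinAt,
    fun h => absurd h (by simp), ?_⟩
  have hnow : ContDiffOn ℝ m x (Ioi a) := hx.mono (Ioi_subset_Ioi (by linarith))
  have hdelay : ContDiffOn ℝ m (fun t => x (t - τ)) (Ioi a) :=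
    hx.comp (contDiff_id.sub contDiff_const).contDiffOn
      fun t ht => sub_lt_sub_right (mem_Ioi.mp ht) τ
  exact (hf.comp_contDiffOn (contDiffOn_id.prodMk (hnow.prodMk hdelay))).congr
    fun t ht => (hderiv t ht).deriv

/-- Smoothing of DDE solutions: if `f` is of class `C^k`, the history function `x₀` is
continuous, and the continuous function `x` agrees with `x₀` for `t ≤ t₀` and is
differentiable at every `t > t₀` with `x' t = f t (x t) (x (t - τ))`, then for every
integer `j` with `1 ≤ j ≤ k + 1` the function `x` is of class `C^j` on the open interval
`(t₀ + (j - 1)τ, ∞)`: crossing each subsequent multiple of the delay gains one additional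
order of smoothness, up to the smoothness of `f`. -/
theorem dde_smoothing
    (n : ℕ) (t₀ τ : ℝ) (hτ : 0 < τ) (k : ℕ)
    (f : ℝ → EuclideanSpace ℝ (Fin n) → EuclideanSpace ℝ (Fin n) → EuclideanSpace ℝ (Fin n))
    (hf : ContDiff ℝ k fun p : ℝ × EuclideanSpace ℝ (Fin n) × EuclideanSpace ℝ (Fin n) =>
      f p.1 p.2.1 p.2.2)
    (x₀ : ℝ → EuclideanSpace ℝ (Fin n)) (hx₀ : Continuous x₀)
    (x : ℝ → EuclideanSpace ℝ (Fin n)) (hx : Continuous x)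
    (hxhist : ∀ t ≤ t₀, x t = x₀ t)
    (hxdde : ∀ t > t₀, HasDerivAt x (f t (x t) (x (t - τ))) t) :
    ∀ j : ℕ, 1 ≤ j → j ≤ k + 1 →
      ContDiffOn ℝ j x (Ioi (t₀ + (j - 1 : ℕ) * τ)) := by
  intro j hj hjk
  obtain ⟨m, rfl⟩ := Nat.exists_eq_add_of_le' hj
  clear hj
  rw [Nat.add_sub_cancel, Nat.cast_add, Nat.cast_one]
  have ha : t₀ ≤ t₀ + m * τ := le_add_of_nonneg_right (by positivity)
  refine contDiffOn_succ_of_hasDerivAt_delay hτ.le ha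
    (hf.of_le (by exact_mod_cast Nat.le_of_succ_le_succ hjk)) hxdde ?_
  clear ha
  induction m with
  | zero => exact (contDiff_zero.mpr hx).contDiffOn
  | succ m ih =>
    have ha : t₀ ≤ t₀ + m * τ := le_add_of_nonneg_right (by positivity)
    have hshift : t₀ + ((m + 1 : ℕ) : ℝ) * τ - τ = t₀ + m * τ := by push_cast; ring
    rw [hshift, Nat.cast_add, Nat.cast_one]
    exact contDiffOn_succ_of_hasDerivAt_delay hτ.le ha
      (hf.of_le (by exact_mod_cast (by omega : m ≤ k))) hxdde (ih (by omega))
end
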